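/- arXiv:1411.7049 — 5 statements merged into one kernel-verified Lean document; each statement's English description precedes it below -/
import Mathlib

section
/- Let Ψ: Ω×Ω→ℝ be a symmetric kernel on a set Ω such that for every finite set of pairwise distinct points X ⊆ Ω the kernel matrix Ψ(X,X) = {Ψ(x_i,x_j)} is symmetric positive definite, and let h: Ω→ℝ^p be a vector of regression functions. Let X₁ ⊆ X₂ be finite sets of pairwise distinct points of Ω, let x ∈ Ω, and assume the matrix H(X₁) (whose rows are h(x_i)' for x_i ∈ X₁) has full column rank p. For a design X define MSPE_X(x) = Ψ(x,x) − (h(x)', Ψ(x,X)) · [[0, H(X)'],[H(X), Ψ(X,X)]]⁻¹ · (h(x); Ψ(X,x)), where Ψ(x,X) is the row vector (Ψ(x,x_i))_{x_i∈X} and Ψ(X,x) its transpose. Then MSPE_{X₂}(x) ≤ MSPE_{X₁}(x). -/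
open Matrix

/-- The mean squared prediction error of the best linear unbiased predictor of a
Gaussian process with regression functions `h` and covariance kernel `Ψ`, based on
observations at the design points `X`, evaluated at the input `x`. -/
noncomputable def MSPE {Ω : Type*} (Ψ : Ω → Ω → ℝ) {p n : ℕ}
    (h : Ω → Fin p → ℝ) (X : Fin n → Ω) (x : Ω) : ℝ :=
  Ψ x x -
    (Sum.elim (h x) fun i => Ψ x (X i)) ⬝ᵥ
      ((Matrix.fromBlocks (0 : Matrix (Fin p) (Fin p) ℝ)
            (Matrix.of fun (j : Fin p) (i : Fin n) => h (X i) j)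
            (Matrix.of fun (i : Fin n) (j : Fin p) => h (X i) j)
            (Matrix.of fun i j => Ψ (X i) (X j)))⁻¹ *ᵥ
        Sum.elim (h x) fun i => Ψ (X i) x)

namespace Matrix

variable {m n : Type*} [Fintype m]

theorem mulVec_injective_of_rank_eq_card {H : Matrix n m ℝ} (hH : H.rank = Fintype.card m) :
    Function.Injective H.mulVec := by
  rw [mulVec_injective_iff, linearIndependent_iff_card_eq_finrank_span, ← hH,
    rank_eq_finrank_span_cols]
  rfl

variable [Fintype n]

/-- A positive definite matrix bordered by a matrix of full column rank is invertible. -/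
theorem PosDef.isUnit_bordered [DecidableEq m] [DecidableEq n] {K : Matrix n n ℝ}
    (hK : K.PosDef) {H : Matrix n m ℝ} (hH : Function.Injective H.mulVec) :
    IsUnit (fromBlocks 0 Hᵀ H K) := by
  rw [← mulVec_injective_iff_isUnit, ← coe_mulVecLin, injective_iff_map_eq_zero]
  intro v hv
  rw [mulVecLin_apply, fromBlocks_mulVec, ← Sum.elim_zero_zero, Sum.elim_eq_iff] at hv
  obtain ⟨hv₁, hv₂⟩ := hv
  rw [zero_mulVec, zero_add] at hv₁
  have hc : v ∘ Sum.inr = 0 := by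
    by_contra hne
    have hpos := hK.dotProduct_mulVec_pos hne
    have horth : (v ∘ Sum.inr) ⬝ᵥ (H *ᵥ (v ∘ Sum.inl)) = 0 := by
      rw [dotProduct_mulVec, ← mulVec_transpose, hv₁, zero_dotProduct]
    have hzero := congrArg ((v ∘ Sum.inr) ⬝ᵥ ·) hv₂
    simp only [dotProduct_add, horth, dotProduct_zero, zero_add] at hzero
    rw [star_trivial] at hpos
    exact hpos.ne' hzero
  rw [hc, mulVec_zero, add_zero] at hv₂
  have hμ : v ∘ Sum.inl = 0 := hH (hv₂.trans (mulVec_zero H).symm)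
  rw [← Sum.elim_comp_inl_inr v, hc, hμ, Sum.elim_zero_zero]

/-- If `H *ᵥ μ + K *ᵥ c = k`, then `c` minimizes the quadratic form `c ⬝ᵥ K *ᵥ c - 2 * (c ⬝ᵥ k)`
among the vectors with the same image under `Hᵀ`. -/
theorem PosSemidef.quadratic_le_of_stationary {K : Matrix n n ℝ} (hK : K.PosSemidef)
    {H : Matrix n m ℝ} {μ : m → ℝ} {c d k : n → ℝ} (hk : H *ᵥ μ + K *ᵥ c = k)
    (hcd : Hᵀ *ᵥ c = Hᵀ *ᵥ d) :
    c ⬝ᵥ K *ᵥ c - 2 * (c ⬝ᵥ k) ≤ d ⬝ᵥ K *ᵥ d - 2 * (d ⬝ᵥ k) := by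
  have hnonneg := hK.dotProduct_mulVec_nonneg (d - c)
  have hsymm : c ⬝ᵥ K *ᵥ d = d ⬝ᵥ K *ᵥ c := by
    have hKt : Kᵀ = K := by simpa using hK.isHermitian.eq
    rw [dotProduct_mulVec, ← mulVec_transpose, hKt, dotProduct_comm]
  have horth : c ⬝ᵥ H *ᵥ μ = d ⬝ᵥ H *ᵥ μ := by
    simp only [dotProduct_mulVec, ← mulVec_transpose, hcd]
  rw [star_trivial, mulVec_sub, sub_dotProduct, dotProduct_sub, dotProduct_sub] at hnonneg
  rw [← hk, dotProduct_add, dotProduct_add]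
  linarith

end Matrix

/-- The MSPE expressed through the weights `c` and Lagrange multipliers `μ` solving the kriging
equations. -/
theorem exists_kriging_weights_MSPE_eq {Ω : Type*} {Ψ : Ω → Ω → ℝ} (hsymm : ∀ u v, Ψ u v = Ψ v u)
    {p n : ℕ} {h : Ω → Fin p → ℝ} {X : Fin n → Ω} {x : Ω}
    {H : Matrix (Fin n) (Fin p) ℝ} (hH : H = Matrix.of fun i j => h (X i) j)
    {K : Matrix (Fin n) (Fin n) ℝ} (hK : K = Matrix.of fun i j => Ψ (X i) (X j))
    (hunit : IsUnit (fromBlocks 0 Hᵀ H K)) :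
    ∃ (μ : Fin p → ℝ) (c : Fin n → ℝ), Hᵀ *ᵥ c = h x ∧
      H *ᵥ μ + K *ᵥ c = (fun i => Ψ (X i) x) ∧
      MSPE Ψ h X x = Ψ x x + (c ⬝ᵥ K *ᵥ c - 2 * (c ⬝ᵥ fun i => Ψ (X i) x)) := by
  set r : Fin p ⊕ Fin n → ℝ := Sum.elim (h x) fun i => Ψ (X i) x
  set w := (fromBlocks 0 Hᵀ H K)⁻¹ *ᵥ r with hw
  have hsolve : fromBlocks 0 Hᵀ H K *ᵥ w = r := by
    rw [hw, mulVec_mulVec, mul_nonsing_inv _ ((isUnit_iff_isUnit_det _).1 hunit), one_mulVec]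
  rw [fromBlocks_mulVec, Sum.elim_eq_iff, zero_mulVec, zero_add] at hsolve
  obtain ⟨h₁, h₂⟩ := hsolve
  refine ⟨w ∘ Sum.inl, w ∘ Sum.inr, h₁, h₂, ?_⟩
  have hM : MSPE Ψ h X x = Ψ x x - r ⬝ᵥ w := by
    subst hH hK
    simp only [MSPE, hsymm x]
    rfl
  have hr : r ⬝ᵥ w = h x ⬝ᵥ (w ∘ Sum.inl) + (w ∘ Sum.inr) ⬝ᵥ fun i => Ψ (X i) x := by
    rw [dotProduct_comm (w ∘ Sum.inr), ← sumElim_dotProduct_sumElim, Sum.elim_comp_inl_inr]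
  have hdual : h x ⬝ᵥ (w ∘ Sum.inl) = (w ∘ Sum.inr) ⬝ᵥ H *ᵥ (w ∘ Sum.inl) := by
    rw [dotProduct_mulVec, ← mulVec_transpose, h₁]
  have hk := congrArg ((w ∘ Sum.inr) ⬝ᵥ ·) h₂
  simp only [dotProduct_add] at hk
  rw [hM, hr, hdual]
  linarith

theorem Function.Injective.extend_zero_dotProduct {ι κ : Type*} [Fintype ι] [Fintype κ]
    {e : ι → κ} (he : Function.Injective e) (c : ι → ℝ) (f : κ → ℝ) :
    Function.extend e c 0 ⬝ᵥ f = c ⬝ᵥ (f ∘ e) := by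
  refine (Fintype.sum_of_injective e he _ _ (fun j hj => ?_) fun i => ?_).symm
  · rw [Function.extend_apply' _ _ _ hj, Pi.zero_apply, zero_mul]
  · rw [he.extend_apply, Function.comp_apply]

/-- Adding design points never increases the mean squared prediction error of the BLUP:
if `X₁ ⊆ X₂` (realized by an embedding `ι` of index sets, `X₁ = X₂ ∘ ι`), every kernel
matrix at distinct points is positive definite, and the regression design matrix of the
smaller design has full column rank, then `MSPE₂ ≤ MSPE₁`. -/
theorem mspe_antitone {Ω : Type*} (Ψ : Ω → Ω → ℝ)
    (hsymm : ∀ u v, Ψ u v = Ψ v u)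
    {p : ℕ} (h : Ω → Fin p → ℝ)
    (hPD : ∀ {m : ℕ} (Y : Fin m → Ω), Function.Injective Y →
      (Matrix.of fun i j => Ψ (Y i) (Y j)).PosDef)
    {n₁ n₂ : ℕ} (ι : Fin n₁ ↪ Fin n₂) (X₂ : Fin n₂ → Ω)
    (hX₂ : Function.Injective X₂) (x : Ω)
    (hrank : (Matrix.of fun (i : Fin n₁) (j : Fin p) => h (X₂ (ι i)) j).rank = p) :
    MSPE Ψ h X₂ x ≤ MSPE Ψ h (X₂ ∘ ι) x := by
  have hι := ι.injective
  set H₂ : Matrix (Fin n₂) (Fin p) ℝ := Matrix.of fun i j => h (X₂ i) j with hH₂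
  set K₂ : Matrix (Fin n₂) (Fin n₂) ℝ := Matrix.of fun i j => Ψ (X₂ i) (X₂ j) with hK₂
  have hinj₁ : Function.Injective (H₂.submatrix ι id).mulVec :=
    mulVec_injective_of_rank_eq_card (hrank.trans (Fintype.card_fin p).symm)
  have hinj₂ : Function.Injective H₂.mulVec := fun u v huv =>
    hinj₁ (funext fun i => congrFun huv (ι i))
  have hpd₁ : (K₂.submatrix ι ι).PosDef := hPD (X₂ ∘ ι) (hX₂.comp hι)
  have hpd₂ : K₂.PosDef := hPD X₂ hX₂
  obtain ⟨-, c₁, hc₁, -, hM₁⟩ := exists_kriging_weights_MSPE_eq (X := X₂ ∘ ι) (x := x) (h := h) hsymm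
    (H := H₂.submatrix ι id) rfl (K := K₂.submatrix ι ι) rfl (hpd₁.isUnit_bordered hinj₁)
  obtain ⟨μ, c₂, hc₂, hk, hM₂⟩ := exists_kriging_weights_MSPE_eq (x := x) hsymm hH₂ hK₂
    (hpd₂.isUnit_bordered hinj₂)
  set d := Function.extend ι c₁ 0
  have hd : H₂ᵀ *ᵥ d = h x := by
    rw [← hc₁]
    funext j
    rw [mulVec, dotProduct_comm, hι.extend_zero_dotProduct, dotProduct_comm]
    rfl
  have hKd : (K₂ *ᵥ d) ∘ ι = K₂.submatrix ι ι *ᵥ c₁ := by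
    funext i
    rw [Function.comp_apply, mulVec, dotProduct_comm, hι.extend_zero_dotProduct, dotProduct_comm]
    rfl
  have hle := hpd₂.posSemidef.quadratic_le_of_stationary hk (hc₂.trans hd.symm)
  rw [hι.extend_zero_dotProduct, hι.extend_zero_dotProduct, hKd] at hle
  rw [hM₁, hM₂]
  exact add_le_add_right hle _
end

section
/- Let Ψ be an n×n real symmetric positive definite matrix, let H ∈ ℝ^{n×p} have full column rank p, and let h ∈ ℝ^p, ψ ∈ ℝⁿ. Then the bordered matrix [[0, H'],[H, Ψ]] is invertible and (h', ψ') · [[0, H'],[H, Ψ]]⁻¹ · (h; ψ) = ψ'Ψ⁻¹ψ − (h − H'Ψ⁻¹ψ)'(H'Ψ⁻¹H)⁻¹(h − H'Ψ⁻¹ψ). -/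
open Matrix

theorem Matrix.mulVec_injective_of_rank_eq_card_s2 {m n K : Type*} [Fintype m] [Fintype n] [Field K]
    {A : Matrix m n K} (hA : A.rank = Fintype.card n) : Function.Injective A.mulVec := by
  rw [Matrix.mulVec_injective_iff, linearIndependent_iff_card_eq_finrank_span, ← hA,
    Matrix.rank_eq_finrank_span_cols, Set.finrank]

theorem Matrix.isUnit_fromBlocks_zero₁₁ {m n R : Type*} [Fintype m] [Fintype n]
    [DecidableEq m] [DecidableEq n] [CommRing R] {B : Matrix m n R} {C : Matrix n m R}
    {D : Matrix n n R} (hD : IsUnit D) (hS : IsUnit (B * D⁻¹ * C)) :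
    IsUnit (Matrix.fromBlocks 0 B C D) := by
  have := hD.invertible
  rw [Matrix.isUnit_fromBlocks_iff_of_invertible₂₂, Matrix.invOf_eq_nonsing_inv, zero_sub]
  exact hS.neg

/-- Block elimination for a linear system whose upper-left block vanishes. -/
theorem Matrix.fromBlocks_zero₁₁_inv_mulVec {m n R : Type*} [Fintype m] [Fintype n]
    [DecidableEq m] [DecidableEq n] [CommRing R] {B : Matrix m n R} {C : Matrix n m R}
    {D : Matrix n n R} (hD : IsUnit D) (hS : IsUnit (B * D⁻¹ * C)) (u : m → R) (v : n → R) :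
    (Matrix.fromBlocks 0 B C D)⁻¹ *ᵥ Sum.elim u v =
      Sum.elim (-((B * D⁻¹ * C)⁻¹ *ᵥ (u - B *ᵥ (D⁻¹ *ᵥ v))))
        (D⁻¹ *ᵥ (v + C *ᵥ ((B * D⁻¹ * C)⁻¹ *ᵥ (u - B *ᵥ (D⁻¹ *ᵥ v))))) := by
  have hM := (Matrix.isUnit_iff_isUnit_det _).1 (Matrix.isUnit_fromBlocks_zero₁₁ hD hS)
  have hD' := (Matrix.isUnit_iff_isUnit_det _).1 hD
  have hS' := (Matrix.isUnit_iff_isUnit_det _).1 hS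
  set w := (B * D⁻¹ * C)⁻¹ *ᵥ (u - B *ᵥ (D⁻¹ *ᵥ v)) with hw
  have hSw : B *ᵥ (D⁻¹ *ᵥ (C *ᵥ w)) = u - B *ᵥ (D⁻¹ *ᵥ v) := by
    rw [Matrix.mulVec_mulVec, Matrix.mulVec_mulVec, hw, Matrix.mulVec_mulVec,
      Matrix.mul_nonsing_inv _ hS', Matrix.one_mulVec]
  have hsol : Matrix.fromBlocks 0 B C D *ᵥ Sum.elim (-w) (D⁻¹ *ᵥ (v + C *ᵥ w)) =
      Sum.elim u v := by
    rw [Matrix.fromBlocks_mulVec, Sum.elim_comp_inl, Sum.elim_comp_inr]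
    congr 1
    · rw [Matrix.zero_mulVec, zero_add, Matrix.mulVec_add, Matrix.mulVec_add, hSw,
        add_sub_cancel]
    · rw [Matrix.mulVec_mulVec, Matrix.mul_nonsing_inv _ hD', Matrix.one_mulVec,
        Matrix.mulVec_neg, add_comm, add_neg_cancel_right]
  rw [← hsol, Matrix.mulVec_mulVec, Matrix.nonsing_inv_mul _ hM, Matrix.one_mulVec]

/-- The bordered matrix `[[0, H'],[H, Ψ]]` with `Ψ` symmetric positive definite and `H`
of full column rank is invertible, and the quadratic form of `(h; ψ)` in its inverse
rewrites as the mean-zero term `ψ'Ψ⁻¹ψ` minus the regression correction term. -/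
theorem bordered_inverse_quadratic_form {n p : ℕ}
    (Ψ : Matrix (Fin n) (Fin n) ℝ) (hΨ : Ψ.PosDef)
    (H : Matrix (Fin n) (Fin p) ℝ) (hH : H.rank = p)
    (h : Fin p → ℝ) (ψ : Fin n → ℝ) :
    IsUnit (Matrix.fromBlocks (0 : Matrix (Fin p) (Fin p) ℝ) Hᵀ H Ψ) ∧
      (Sum.elim h ψ) ⬝ᵥ
          ((Matrix.fromBlocks (0 : Matrix (Fin p) (Fin p) ℝ) Hᵀ H Ψ)⁻¹ *ᵥ
            Sum.elim h ψ) =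
        ψ ⬝ᵥ (Ψ⁻¹ *ᵥ ψ) -
          (h - Hᵀ *ᵥ (Ψ⁻¹ *ᵥ ψ)) ⬝ᵥ
            ((Hᵀ * Ψ⁻¹ * H)⁻¹ *ᵥ (h - Hᵀ *ᵥ (Ψ⁻¹ *ᵥ ψ))) := by
  have hS : IsUnit (Hᵀ * Ψ⁻¹ * H) := by
    have hinj := Matrix.mulVec_injective_of_rank_eq_card_s2 (hH.trans (Fintype.card_fin p).symm)
    have hpd := (hΨ.inv.conjTranspose_mul_mul_same hinj).isUnit
    rwa [Matrix.conjTranspose_eq_transpose_of_trivial] at hpd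
  refine ⟨Matrix.isUnit_fromBlocks_zero₁₁ hΨ.isUnit hS, ?_⟩
  have hsymm : (Ψ⁻¹)ᵀ = Ψ⁻¹ := by
    rw [← Matrix.conjTranspose_eq_transpose_of_trivial]
    exact hΨ.inv.isHermitian
  rw [Matrix.fromBlocks_zero₁₁_inv_mulVec hΨ.isUnit hS]
  set w := (Hᵀ * Ψ⁻¹ * H)⁻¹ *ᵥ (h - Hᵀ *ᵥ (Ψ⁻¹ *ᵥ ψ))
  have hadj : ψ ⬝ᵥ (Ψ⁻¹ *ᵥ (H *ᵥ w)) = (Hᵀ *ᵥ (Ψ⁻¹ *ᵥ ψ)) ⬝ᵥ w := by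
    rw [Matrix.dotProduct_mulVec, Matrix.dotProduct_mulVec, ← Matrix.mulVec_transpose,
      ← Matrix.mulVec_transpose, hsymm]
  rw [sumElim_dotProduct_sumElim, dotProduct_neg, Matrix.mulVec_add, dotProduct_add, hadj,
    sub_dotProduct]
  ring
end

section
/- Let Ω be a set, let Ψ: Ω×Ω→ℝ be symmetric with nonnegative values and Ψ(x,x) = σ² for all x ∈ Ω, and suppose S = sup_{u,v∈Ω} Ψ(u,v) is finite. Let X = {x₁,…,xₙ} ⊆ Ω be such that the n×n kernel matrix Ψ(X,X) = {Ψ(x_i,x_j)} is positive definite, let A₁,…,Aₙ be a covering of Ω (i.e. Ω ⊆ ∪_{i=1}^n A_i) with x_i ∈ A_i for each i, and set k = nS and m = min_i inf_{x∈A_i} Ψ(x_i,x). Then sup_{x∈Ω} [Ψ(x,x) − Ψ(x,X)Ψ(X,X)⁻¹Ψ(X,x)] ≤ (1/k)(σ² − m)(2k − σ² + m). -/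
open Matrix

/-- The prediction variance reduction `v ⬝ K⁻¹ v` dominates that of every linear predictor. -/
lemma Matrix.PosDef.two_mul_dotProduct_sub_le {ι : Type*} [Fintype ι] [DecidableEq ι]
    {K : Matrix ι ι ℝ} (hK : K.PosDef) (v w : ι → ℝ) :
    2 * (w ⬝ᵥ v) - w ⬝ᵥ (K *ᵥ w) ≤ v ⬝ᵥ (K⁻¹ *ᵥ v) := by
  have hT : Kᵀ = K := by simpa using hK.isHermitian.eq
  have hu : K *ᵥ (K⁻¹ *ᵥ v) = v := by
    rw [mulVec_mulVec, mul_nonsing_inv _ hK.det_pos.ne'.isUnit, one_mulVec]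
  set u := K⁻¹ *ᵥ v
  have h := hK.posSemidef.dotProduct_mulVec_nonneg (w - u)
  have hsw : u ⬝ᵥ (K *ᵥ w) = w ⬝ᵥ v := by
    rw [dotProduct_mulVec, ← mulVec_transpose, hT, hu, dotProduct_comm]
  simp only [star_trivial, mulVec_sub, sub_dotProduct, dotProduct_sub, hu, hsw] at h
  rw [dotProduct_comm v u]
  linarith

/-- A quadratic form with entries bounded by `S` in absolute value is at most `n S` times the
squared Euclidean norm. -/
lemma Matrix.dotProduct_mulVec_le_card_mul {ι : Type*} [Fintype ι]
    {K : Matrix ι ι ℝ} {S : ℝ} (hK : ∀ i j, |K i j| ≤ S) (g : ι → ℝ) :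
    g ⬝ᵥ (K *ᵥ g) ≤ Fintype.card ι * S * (g ⬝ᵥ g) := by
  have hterm : ∀ i j, g i * (K i j * g j) ≤ S / 2 * (g i * g i) + S / 2 * (g j * g j) := by
    intro i j
    obtain ⟨h₁, h₂⟩ := abs_le.mp (hK i j)
    nlinarith [mul_nonneg (sub_nonneg.2 h₂) (sq_nonneg (g i + g j)),
      mul_nonneg (sub_nonneg.2 h₁) (sq_nonneg (g i - g j))]
  calc g ⬝ᵥ (K *ᵥ g) = ∑ i, ∑ j, g i * (K i j * g j) := by
        simp only [dotProduct, mulVec, Finset.mul_sum]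
    _ ≤ ∑ i, ∑ j, (S / 2 * (g i * g i) + S / 2 * (g j * g j)) :=
        Finset.sum_le_sum fun i _ => Finset.sum_le_sum fun j _ => hterm i j
    _ = Fintype.card ι * S * (g ⬝ᵥ g) := by
        simp only [Finset.sum_add_distrib, ← Finset.mul_sum, Finset.sum_const, Finset.card_univ,
          nsmul_eq_mul, dotProduct]
        simp only [mul_left_comm (g _), ← Finset.mul_sum]
        ring

/-- Lower bound on `v ⬝ K⁻¹ v` obtained from one gradient step starting at a basis vector. -/
lemma Matrix.PosDef.le_dotProduct_inv_mulVec {ι : Type*} [Fintype ι] [DecidableEq ι]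
    {K : Matrix ι ι ℝ} (hK : K.PosDef) {k : ℝ} (hk : 0 < k)
    (hbound : ∀ g : ι → ℝ, g ⬝ᵥ (K *ᵥ g) ≤ k * (g ⬝ᵥ g)) (v : ι → ℝ) (i : ι) :
    2 * v i - K i i + (K i i - v i) ^ 2 / k ≤ v ⬝ᵥ (K⁻¹ *ᵥ v) := by
  have hT : Kᵀ = K := by simpa using hK.isHermitian.eq
  set e : ι → ℝ := Pi.single i 1 with he
  set g : ι → ℝ := K *ᵥ e - v with hg
  have hKe : K *ᵥ e = g + v := by simp [hg]
  have hgi : g i = K i i - v i := by simp [hg, he]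
  have hev : e ⬝ᵥ v = v i := by simp [he]
  have heg : e ⬝ᵥ g = K i i - v i := by rw [← hgi]; simp [he]
  have hKg : e ⬝ᵥ (K *ᵥ g) = g ⬝ᵥ g + g ⬝ᵥ v := by
    rw [dotProduct_mulVec, ← mulVec_transpose, hT, hKe, dotProduct_comm, dotProduct_add]
  have hsq : (K i i - v i) ^ 2 ≤ g ⬝ᵥ g := by
    rw [← hgi, sq]
    exact Finset.single_le_sum (f := fun j => g j * g j) (fun j _ => mul_self_nonneg _)
      (Finset.mem_univ i)
  have h := hK.two_mul_dotProduct_sub_le v (e - k⁻¹ • g)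
  simp only [mulVec_sub, mulVec_smul, sub_dotProduct, dotProduct_sub, smul_dotProduct,
    dotProduct_smul, smul_eq_mul, hKe, hKg, dotProduct_add, hev, heg] at h
  have h₁ : k⁻¹ * (k⁻¹ * (g ⬝ᵥ (K *ᵥ g))) ≤ k⁻¹ * (g ⬝ᵥ g) := by
    refine mul_le_mul_of_nonneg_left ?_ (inv_nonneg.2 hk.le)
    rw [inv_mul_le_iff₀ hk]
    exact hbound g
  have h₂ : (K i i - v i) ^ 2 / k ≤ k⁻¹ * (g ⬝ᵥ g) := by
    rw [div_eq_inv_mul]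
    exact mul_le_mul_of_nonneg_left hsq (inv_nonneg.2 hk.le)
  linarith

/-- Theorem 2 (nominal error bound): if `A₁, …, Aₙ` cover `Ω`, the kernel `Ψ` is symmetric,
nonnegative, constant equal to `σ²` on the diagonal with finite supremum `S`, the kernel
matrix at the design points is positive definite, and `xᵢ ∈ Aᵢ`, then with `k = n·S` and
`m = minᵢ inf_{x ∈ Aᵢ} Ψ(xᵢ, x)` the mean squared prediction error is bounded at every
input by `(1/k)(σ² − m)(2k − σ² + m)`. -/
theorem nominal_error_bound {Ω : Type*} {n : ℕ} (hn : 0 < n)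
    (Ψ : Ω → Ω → ℝ)
    (hsymm : ∀ u v, Ψ u v = Ψ v u)
    (hnonneg : ∀ u v, 0 ≤ Ψ u v)
    (σ2 : ℝ) (hdiag : ∀ x, Ψ x x = σ2)
    (S : ℝ) (hS : IsLUB {r : ℝ | ∃ u v, r = Ψ u v} S)
    (X : Fin n → Ω)
    (hPD : (Matrix.of fun i j => Ψ (X i) (X j)).PosDef)
    (A : Fin n → Set Ω)
    (hcover : ∀ x : Ω, ∃ i, x ∈ A i)
    (hmem : ∀ i, X i ∈ A i) :
    ∀ x : Ω,
      Ψ x x -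
          (fun i => Ψ x (X i)) ⬝ᵥ
            ((Matrix.of fun i j => Ψ (X i) (X j))⁻¹ *ᵥ fun i => Ψ (X i) x) ≤
        (1 / (n * S)) * (σ2 - ⨅ i, sInf ((fun y => Ψ (X i) y) '' A i)) *
          (2 * (n * S) - σ2 + ⨅ i, sInf ((fun y => Ψ (X i) y) '' A i)) := by
  intro x
  obtain ⟨i, hi⟩ := hcover x
  have hle : ∀ u v, Ψ u v ≤ S := fun u v => hS.1 ⟨u, v, rfl⟩
  have hσ : 0 < σ2 := by simpa [hdiag] using hPD.diag_pos (i := i)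
  have hσS : σ2 ≤ S := hdiag x ▸ hle x x
  have hn1 : (1 : ℝ) ≤ n := by exact_mod_cast hn
  have hSk : S ≤ n * S := le_mul_of_one_le_left (hσ.le.trans hσS) hn1
  have hk : (0 : ℝ) < n * S := by linarith
  set m := ⨅ i, sInf ((fun y => Ψ (X i) y) '' A i) with hm
  have hm0 : 0 ≤ m := Real.iInf_nonneg fun j => Real.sInf_nonneg (by
    rintro _ ⟨y, -, rfl⟩
    exact hnonneg _ _)
  have hmi : m ≤ Ψ (X i) x := (ciInf_le (Set.finite_range _).bddBelow i).trans
    (csInf_le ⟨0, by rintro _ ⟨y, -, rfl⟩; exact hnonneg _ _⟩ ⟨x, hi, rfl⟩)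
  have h := hPD.le_dotProduct_inv_mulVec hk (fun g => by
    simpa using Matrix.dotProduct_mulVec_le_card_mul (S := S)
      (fun a b => by simpa [abs_of_nonneg (hnonneg _ _)] using hle (X a) (X b)) g)
    (fun j => Ψ (X j) x) i
  simp only [Matrix.of_apply, hdiag] at h
  simp only [hsymm x, hdiag x] at h ⊢
  generalize (n : ℝ) * S = k at *
  have hmono : (σ2 - Ψ (X i) x) * (2 * k - (σ2 - Ψ (X i) x)) ≤
      (σ2 - m) * (2 * k - (σ2 - m)) := by
    nlinarith [mul_nonneg (sub_nonneg.2 hmi)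
      (by linarith [hnonneg (X i) x] : 0 ≤ 2 * k - (σ2 - m) - (σ2 - Ψ (X i) x))]
  have hdiv := div_le_div_of_nonneg_right hmono hk.le
  have hL : (σ2 - Ψ (X i) x) * (2 * k - (σ2 - Ψ (X i) x)) / k =
      2 * (σ2 - Ψ (X i) x) - (σ2 - Ψ (X i) x) ^ 2 / k := by
    field_simp
  have hR : 1 / k * (σ2 - m) * (2 * k - σ2 + m) = (σ2 - m) * (2 * k - (σ2 - m)) / k := by
    ring
  linarith
end

section
/- Let K be an n×n real symmetric positive definite matrix, let ψ ∈ ℝⁿ, let i ∈ {1,…,n}, and let λ_max(K) denote the largest eigenvalue of K. Then ψ'K⁻¹ψ ≥ 2ψ_i − K_{ii} + (ψ_i − K_{ii})²/λ_max(K); equivalently, for any scalar s, s − ψ'K⁻¹ψ ≤ s − 2ψ_i + K_{ii} − (ψ_i − K_{ii})²/λ_max(K). -/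
open Matrix

/-- The largest eigenvalue of a symmetric matrix, characterized as the supremum of its
Rayleigh quotient over Euclidean unit vectors. -/
noncomputable def lamMax {n : ℕ} (A : Matrix (Fin n) (Fin n) ℝ) : ℝ :=
  sSup {r : ℝ | ∃ v : Fin n → ℝ, (∑ i, v i ^ 2) = 1 ∧ r = v ⬝ᵥ (A *ᵥ v)}

/-- Cauchy–Schwarz for the form of a positive semidefinite matrix, against a basis vector. -/
lemma Matrix.PosSemidef.sq_mulVec_apply_le {n : Type*} [Fintype n]
    {K : Matrix n n ℝ} (hK : K.PosSemidef) (v : n → ℝ) (i : n) :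
    (K *ᵥ v) i ^ 2 ≤ K i i * (v ⬝ᵥ (K *ᵥ v)) := by
  classical
  have hsymm : Kᵀ = K := by simpa [Matrix.IsHermitian] using hK.isHermitian
  have hcross : v ⬝ᵥ K.col i = (K *ᵥ v) i := by
    rw [dotProduct_comm]
    conv_rhs => rw [← hsymm]
    rfl
  have hquad (t : ℝ) : 0 ≤ K i i * (t * t) + 2 * (K *ᵥ v) i * t + v ⬝ᵥ (K *ᵥ v) := by
    have h := hK.dotProduct_mulVec_nonneg (v + t • Pi.single i 1)
    simp only [star_trivial, mulVec_add, mulVec_smul, mulVec_single_one, add_dotProduct,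
      dotProduct_add, smul_dotProduct, dotProduct_smul, single_one_dotProduct, hcross,
      smul_eq_mul, col_apply] at h
    linarith
  have h := discrim_le_zero hquad
  rw [discrim] at h
  linarith

/-- The Rayleigh quotient of a matrix is bounded above on the Euclidean unit sphere. -/
lemma bddAbove_rayleigh {n : ℕ} (A : Matrix (Fin n) (Fin n) ℝ) :
    BddAbove {r : ℝ | ∃ v : Fin n → ℝ, (∑ i, v i ^ 2) = 1 ∧ r = v ⬝ᵥ (A *ᵥ v)} := by
  refine ⟨∑ i, ∑ j, |A i j|, ?_⟩
  rintro r ⟨v, hv, rfl⟩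
  have hle (i : Fin n) : |v i| ≤ 1 := by
    rw [← sq_le_one_iff_abs_le_one, ← hv]
    exact Finset.single_le_sum (f := fun j => v j ^ 2) (fun j _ => sq_nonneg _)
      (Finset.mem_univ i)
  simp only [dotProduct, mulVec, Finset.mul_sum]
  refine Finset.sum_le_sum fun i _ => Finset.sum_le_sum fun j _ => ?_
  calc v i * (A i j * v j) ≤ |v i * (A i j * v j)| := le_abs_self _
    _ = |v i| * (|A i j| * |v j|) := by rw [abs_mul, abs_mul]
    _ ≤ 1 * (|A i j| * 1) := by gcongr <;> exact hle _
    _ = |A i j| := by ring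

lemma diag_le_lamMax {n : ℕ} (A : Matrix (Fin n) (Fin n) ℝ) (i : Fin n) :
    A i i ≤ lamMax A :=
  le_csSup (bddAbove_rayleigh A) ⟨Pi.single i 1, by simp [Pi.single_apply], by simp⟩


/-- For a symmetric positive definite matrix `K`, a vector `ψ` and an index `i`:
`ψ'K⁻¹ψ ≥ 2ψᵢ − Kᵢᵢ + (ψᵢ − Kᵢᵢ)²/λ_max(K)`; equivalently, for any scalar `s`,
`s − ψ'K⁻¹ψ ≤ s − 2ψᵢ + Kᵢᵢ − (ψᵢ − Kᵢᵢ)²/λ_max(K)`. -/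
theorem quad_form_inv_lower_bound {n : ℕ} (K : Matrix (Fin n) (Fin n) ℝ)
    (hK : K.PosDef) (ψ : Fin n → ℝ) (i : Fin n) :
    ψ ⬝ᵥ (K⁻¹ *ᵥ ψ) ≥ 2 * ψ i - K i i + (ψ i - K i i) ^ 2 / lamMax K ∧
      ∀ s : ℝ,
        s - ψ ⬝ᵥ (K⁻¹ *ᵥ ψ) ≤
          s - 2 * ψ i + K i i - (ψ i - K i i) ^ 2 / lamMax K := by
  have hpos : 0 < K i i := hK.diag_pos
  have hinv : K *ᵥ (K⁻¹ *ᵥ ψ) = ψ := by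
    rw [mulVec_mulVec, mul_nonsing_inv _ ((isUnit_iff_isUnit_det K).mp hK.isUnit), one_mulVec]
  have hcs : ψ i ^ 2 / K i i ≤ ψ ⬝ᵥ (K⁻¹ *ᵥ ψ) := by
    have h := hK.posSemidef.sq_mulVec_apply_le (K⁻¹ *ᵥ ψ) i
    rw [hinv, dotProduct_comm] at h
    rwa [div_le_iff₀' hpos]
  have hlam : (ψ i - K i i) ^ 2 / lamMax K ≤ (ψ i - K i i) ^ 2 / K i i := by
    gcongr
    exact diag_le_lamMax K i
  have hsq : ψ i ^ 2 / K i i = 2 * ψ i - K i i + (ψ i - K i i) ^ 2 / K i i := by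
    field_simp
    ring
  exact ⟨by linarith, fun s => by linarith⟩
end

section
/- Let Ω ⊆ ℝ^d, let Θ be a nonsingular d×d real matrix, let σ² > 0, and let φ: [0,∞) → ℝ be a nonincreasing nonnegative function with φ(0) = 1. Suppose Ψ(u,v) = σ²φ(‖Θ(u−v)‖₂) is such that for the pairwise distinct points X = {x₁,…,xₙ} ⊆ Ω the matrix Ψ(X,X) is positive definite. Let h = sup_{x∈Ω} min_i ‖Θ(x − x_i)‖₂ be the fill distance of X in Ω with respect to the distance d_Θ(u,v) = ‖Θ(u−v)‖₂, and set k = nσ². Then sup_{x∈Ω} [σ² − Ψ(x,X)Ψ(X,X)⁻¹Ψ(X,x)] ≤ (1/k)(σ² − σ²φ(h))(2k − σ² + σ²φ(h)). -/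
open Matrix

/-- The Euclidean norm of a vector in `ℝ^d`. -/
noncomputable def euclNorm {d : ℕ} (v : Fin d → ℝ) : ℝ :=
  Real.sqrt (∑ i, v i ^ 2)

/-- Conditioning on one coordinate: for positive definite `A`, the quadratic form of `A⁻¹` at `b`
dominates the contribution of any single coordinate of `b`. -/
theorem Matrix.PosDef.sq_le_diag_mul_dotProduct_inv_mulVec {ι : Type*} [Fintype ι] [DecidableEq ι]
    {A : Matrix ι ι ℝ} (hA : A.PosDef) (b : ι → ℝ) (j : ι) :
    b j ^ 2 ≤ A j j * (b ⬝ᵥ (A⁻¹ *ᵥ b)) := by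
  have hdiag : 0 < A j j := hA.diag_pos
  have hsymm : Aᵀ = A := by simpa [conjTranspose_eq_transpose_of_trivial] using hA.isHermitian.eq
  set y := A⁻¹ *ᵥ b with hy
  have hAy : A *ᵥ y = b := by
    rw [hy, mulVec_mulVec, mul_nonsing_inv A ((isUnit_iff_isUnit_det A).1 hA.isUnit), one_mulVec]
  have hyA : y ⬝ᵥ (A *ᵥ Pi.single j (1 : ℝ)) = b j := by
    rw [dotProduct_mulVec, ← mulVec_transpose, hsymm, hAy]
    simp
  rw [mulVec_single_one] at hyA
  have hquad := hA.posSemidef.dotProduct_mulVec_nonneg (A j j • y - b j • Pi.single j (1 : ℝ))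
  have hexpand : (A j j • y - b j • Pi.single j (1 : ℝ)) ⬝ᵥ
      (A *ᵥ (A j j • y - b j • Pi.single j (1 : ℝ))) =
      A j j * (A j j * (b ⬝ᵥ y) - b j ^ 2) := by
    simp only [mulVec_sub, mulVec_smul, hAy, sub_dotProduct, dotProduct_sub, smul_dotProduct,
      dotProduct_smul, hyA, dotProduct_comm y b, smul_eq_mul, single_one_dotProduct, mulVec_single_one,
      col_apply]
    ring
  rw [star_trivial, hexpand] at hquad
  linarith [nonneg_of_mul_nonneg_right hquad hdiag]

theorem euclNorm_zero {d : ℕ} : euclNorm (0 : Fin d → ℝ) = 0 := by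
  simp [euclNorm]

theorem euclNorm_nonneg {d : ℕ} (v : Fin d → ℝ) : 0 ≤ euclNorm v :=
  Real.sqrt_nonneg _

/-- Nominal error bound in the stationary case (Case 1): for the kernel
`Ψ(u,v) = σ²φ(‖Θ(u−v)‖₂)` with `φ` nonincreasing, nonnegative and `φ(0) = 1`, if `fd` is
the fill distance of the design `X` in `Ω` with respect to `d_Θ`, then with `k = nσ²` the
mean squared prediction error at every `x ∈ Ω` is at most
`(1/k)(σ² − σ²φ(fd))(2k − σ² + σ²φ(fd))`. -/
theorem stationary_nominal_error_bound {d n : ℕ} (hn : 0 < n)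
    (Ω : Set (Fin d → ℝ))
    (Θ : Matrix (Fin d) (Fin d) ℝ) (hΘ : IsUnit Θ.det)
    (σ2 : ℝ) (hσ2 : 0 < σ2)
    (φ : ℝ → ℝ)
    (hφ_anti : ∀ s t, 0 ≤ s → s ≤ t → φ t ≤ φ s)
    (hφ_nonneg : ∀ t, 0 ≤ t → 0 ≤ φ t)
    (hφ0 : φ 0 = 1)
    (X : Fin n → (Fin d → ℝ)) (hXinj : Function.Injective X)
    (hXΩ : ∀ i, X i ∈ Ω)
    (hPD : (Matrix.of fun i j => σ2 * φ (euclNorm (Θ *ᵥ (X i - X j)))).PosDef)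
    (fd : ℝ)
    (hfd : IsLUB {r : ℝ | ∃ x ∈ Ω, r = ⨅ i, euclNorm (Θ *ᵥ (x - X i))} fd) :
    ∀ x ∈ Ω,
      σ2 -
          (fun i => σ2 * φ (euclNorm (Θ *ᵥ (x - X i)))) ⬝ᵥ
            ((Matrix.of fun i j => σ2 * φ (euclNorm (Θ *ᵥ (X i - X j))))⁻¹ *ᵥ
              fun i => σ2 * φ (euclNorm (Θ *ᵥ (x - X i)))) ≤
        (1 / (n * σ2)) * (σ2 - σ2 * φ fd) * (2 * (n * σ2) - σ2 + σ2 * φ fd) := by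
  intro x hx
  have : Nonempty (Fin n) := ⟨⟨0, hn⟩⟩
  obtain ⟨j, hj⟩ := exists_eq_ciInf_of_finite (f := fun i => euclNorm (Θ *ᵥ (x - X i)))
  have hle : euclNorm (Θ *ᵥ (x - X j)) ≤ fd := hfd.1 ⟨x, hx, hj⟩
  have hdist := euclNorm_nonneg (Θ *ᵥ (x - X j))
  have hfd0 : 0 ≤ fd := hdist.trans hle
  have hanti := hφ_anti _ _ hdist hle
  have hφfd := hφ_nonneg fd hfd0
  have hpred := hPD.sq_le_diag_mul_dotProduct_inv_mulVec
    (fun i => σ2 * φ (euclNorm (Θ *ᵥ (x - X i)))) j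
  simp only [of_apply, sub_self, mulVec_zero, euclNorm_zero, hφ0, mul_one] at hpred
  set q := (fun i => σ2 * φ (euclNorm (Θ *ᵥ (x - X i)))) ⬝ᵥ
    ((Matrix.of fun i j => σ2 * φ (euclNorm (Θ *ᵥ (X i - X j))))⁻¹ *ᵥ
      fun i => σ2 * φ (euclNorm (Θ *ᵥ (x - X i))))
  have hn1 : (1 : ℝ) ≤ n := by exact_mod_cast hn
  have hq : σ2 * φ (euclNorm (Θ *ᵥ (x - X j))) ^ 2 ≤ q := by
    refine le_of_mul_le_mul_left ?_ hσ2
    linarith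
  have hsq : φ fd ^ 2 ≤ φ (euclNorm (Θ *ᵥ (x - X j))) ^ 2 := by gcongr
  have hrhs : (1 / (n * σ2)) * (σ2 - σ2 * φ fd) * (2 * (n * σ2) - σ2 + σ2 * φ fd) =
      σ2 * (2 * (1 - φ fd) - (1 - φ fd) ^ 2 / n) := by
    field_simp
    ring
  have hdiv : (1 - φ fd) ^ 2 / n ≤ (1 - φ fd) ^ 2 := div_le_self (sq_nonneg _) hn1
  calc σ2 - q ≤ σ2 * (1 - φ fd ^ 2) := by linarith [mul_le_mul_of_nonneg_left hsq hσ2.le]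
    _ ≤ σ2 * (2 * (1 - φ fd) - (1 - φ fd) ^ 2 / n) := by
      refine mul_le_mul_of_nonneg_left ?_ hσ2.le
      linarith
    _ = _ := hrhs.symm
end
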